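/- Let n = p^α q^β with p, q distinct primes, α, β ≥ 1, X a finite set, and f : X → ℤ/nℤ. Let K_p = ⟨n/p⟩ and K_q = ⟨n/q⟩ in ℤ/nℤ. Then f is 1-balanced (∑_{s∈X} exp(2πi f(s)/n) = 0) if and only if X can be partitioned into disjoint subsets X_p and X_q such that every coset of K_p is evenly covered by f restricted to X_p, and every coset of K_q is evenly covered by f restricted to X_q. -/

import Mathlib

/-- If `c` satisfies the rectangle identity along two subgroups `H` and `K`, then it is the sum of an
`H`-invariant and a `K`-invariant function with natural number values. -/
theorem exists_add_invariant_of_rectangle {G : Type*} [AddCommGroup G] (H K : AddSubgroup G)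
    (c : G → ℕ)
    (hc : ∀ x, ∀ h ∈ H, ∀ k ∈ K, c x + c (x + h + k) = c (x + h) + c (x + k)) :
    ∃ a b : G → ℕ, (∀ x, c x = a x + b x) ∧ (∀ x y, x - y ∈ H → a x = a y) ∧
      (∀ x y, x - y ∈ K → b x = b y) := by
  let a : G → ℕ := fun x => ⨅ h : H, c (x + h)
  have ha_le (x : G) (h : G) (hh : h ∈ H) : a x ≤ c (x + h) :=
    ciInf_le (OrderBot.bddBelow _) (⟨h, hh⟩ : H)
  have ha_mem (x : G) : ∃ h ∈ H, c (x + h) = a x := by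
    obtain ⟨h, hh⟩ := Nat.sInf_mem (Set.range_nonempty fun h : H => c (x + h))
    exact ⟨h, h.2, hh⟩
  have ha_le_self (x : G) : a x ≤ c x := by simpa using ha_le x 0 H.zero_mem
  have ha_H (x y : G) (hxy : x - y ∈ H) : a x ≤ a y := by
    obtain ⟨h, hh, e⟩ := ha_mem y
    have := ha_le x (h - (x - y)) (H.sub_mem hh hxy)
    rwa [show x + (h - (x - y)) = y + h by abel, e] at this
  have ha_K (x k : G) (hk : k ∈ K) : c x + a (x + k) ≤ c (x + k) + a x := by
    obtain ⟨h, hh, e⟩ := ha_mem x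
    have h₁ := ha_le (x + k) h hh
    have h₂ := hc x h hh k hk
    rw [add_right_comm x k h] at h₁
    omega
  refine ⟨a, fun x => c x - a x, fun x => ?_, fun x y hxy => ?_, fun x y hxy => ?_⟩
  · exact (Nat.add_sub_cancel' (ha_le_self x)).symm
  · exact le_antisymm (ha_H x y hxy) (ha_H y x (by simpa using H.neg_mem hxy))
  · have h₁ := ha_K y (x - y) hxy
    have h₂ := ha_K x (y - x) (by simpa using K.neg_mem hxy)
    rw [add_sub_cancel] at h₁ h₂
    have := ha_le_self x
    have := ha_le_self y
    simp only
    omega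

namespace ZMod

variable {n : ℕ} [NeZero n]

theorem isPrimitiveRoot_stdAddChar_one : IsPrimitiveRoot (stdAddChar (1 : ZMod n)) n := by
  have h := stdAddChar_coe (N := n) 1
  rw [Int.cast_one] at h
  rw [h]
  simpa using Complex.isPrimitiveRoot_exp n (NeZero.ne n)

theorem stdAddChar_eq_exp (x : ZMod n) :
    stdAddChar x = Complex.exp (2 * Real.pi * Complex.I * x.val / n) := by
  have h := stdAddChar_coe (N := n) x.val
  simpa using h

theorem stdAddChar_mul_eq_pow (x k : ZMod n) :
    stdAddChar (x * k) = stdAddChar k ^ x.val := by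
  rw [← AddChar.map_nsmul_eq_pow, nsmul_eq_mul, natCast_zmod_val]

/-- An integral linear relation between roots of unity is preserved by Galois conjugation. -/
theorem sum_mul_stdAddChar_mul_eq_zero (c : ZMod n → ℤ)
    (h : ∑ x, (c x : ℂ) * stdAddChar x = 0) {k : ZMod n} (hk : IsUnit k) :
    ∑ x, (c x : ℂ) * stdAddChar (x * k) = 0 := by
  let P : Polynomial ℤ := ∑ x : ZMod n, Polynomial.C (c x) * Polynomial.X ^ x.val
  have hP (k : ZMod n) :
      Polynomial.aeval (stdAddChar k : ℂ) P = ∑ x, (c x : ℂ) * stdAddChar (x * k) := by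
    simp [P, stdAddChar_mul_eq_pow]
  have hζ := isPrimitiveRoot_stdAddChar_one (n := n)
  have hkn : k.val.Coprime n := by
    rwa [← isUnit_iff_coprime, natCast_zmod_val]
  have hdvd : minpoly ℤ (stdAddChar (1 : ZMod n)) ∣ P := by
    refine minpoly.isIntegrallyClosed_dvd (hζ.isIntegral (NeZero.pos n)) ?_
    simpa [hP] using h
  rw [hζ.minpoly_eq_pow_coprime hkn, ← stdAddChar_mul_eq_pow, mul_one] at hdvd
  rw [← hP]
  exact Polynomial.aeval_eq_zero_of_dvd_aeval_eq_zero hdvd (minpoly.aeval _ _)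

theorem sum_comp_add_right_mul_stdAddChar (c : ZMod n → ℂ) (u k : ZMod n) :
    ∑ x, c (x + u) * stdAddChar (x * k) =
      stdAddChar (-(u * k)) * ∑ x, c x * stdAddChar (x * k) := by
  rw [← Equiv.sum_comp (Equiv.addRight u) fun x => c x * stdAddChar (x * k), Finset.mul_sum]
  refine Finset.sum_congr rfl fun x _ => ?_
  rw [Equiv.coe_addRight, mul_left_comm, ← AddChar.map_add_eq_mul]
  congr 2
  ring

/-- A vanishing sum of `n`-th roots of unity has multiplicities satisfying the rectangle identity
along `u` and `v`, provided that every non-unit of `ZMod n` annihilates `u` or `v`. -/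
theorem rectangle_of_sum_mul_stdAddChar_eq_zero (c : ZMod n → ℤ)
    (h : ∑ x, (c x : ℂ) * stdAddChar x = 0) {u v : ZMod n}
    (huv : ∀ k : ZMod n, IsUnit k ∨ u * k = 0 ∨ v * k = 0) (x : ZMod n) :
    c x + c (x + u + v) = c (x + u) + c (x + v) := by
  let e : ZMod n → ℂ := fun x => c x - c (x + u) - c (x + v) + c (x + u + v)
  have key (k : ZMod n) : ∑ x, e x * stdAddChar (x * k) = 0 := by
    have h₁ : ∑ x, e x * stdAddChar (x * k) =
        (1 - stdAddChar (-(u * k))) * (1 - stdAddChar (-(v * k))) *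
          ∑ x, (c x : ℂ) * stdAddChar (x * k) := by
      have hu := sum_comp_add_right_mul_stdAddChar (fun x => (c x : ℂ)) u k
      have hv := sum_comp_add_right_mul_stdAddChar (fun x => (c x : ℂ)) v k
      have huv := sum_comp_add_right_mul_stdAddChar (fun x => (c (x + v) : ℂ)) u k
      simp only [e, add_mul, sub_mul, Finset.sum_add_distrib, Finset.sum_sub_distrib]
      rw [huv, hv, hu]
      ring
    rw [h₁]
    rcases huv k with hk | hk | hk
    · rw [sum_mul_stdAddChar_mul_eq_zero c h hk, mul_zero]
    · simp [hk]
    · simp [hk]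
  have he : e = 0 := by
    refine dft.map_eq_zero_iff.mp (funext fun k => ?_)
    rw [dft_apply, Pi.zero_apply, ← key (-k)]
    refine Finset.sum_congr rfl fun x _ => ?_
    rw [smul_eq_mul, mul_comm, mul_neg]
  have hx := congrFun he x
  simp only [e, Pi.zero_apply] at hx
  have hx' : c x - c (x + u) - c (x + v) + c (x + u + v) = 0 := by exact_mod_cast hx
  linarith

theorem sum_mul_stdAddChar_eq_zero_of_periodic (c : ZMod n → ℂ) {u : ZMod n} (hu : u ≠ 0)
    (hc : ∀ x, c (x + u) = c x) : ∑ x, c x * stdAddChar x = 0 := by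
  have h := sum_comp_add_right_mul_stdAddChar c u 1
  simp only [hc, mul_one] at h
  have hne : stdAddChar (-u) ≠ (1 : ℂ) := by
    rw [← AddChar.map_zero_eq_one (stdAddChar (N := n))]
    exact fun h' => hu (neg_eq_zero.mp (injective_stdAddChar h'))
  by_contra h0
  exact hne (mul_right_cancel₀ h0 (by rw [← h, one_mul]))

theorem natCast_div_ne_zero {p : ℕ} (hp : 1 < p) (hpn : p ∣ n) : ((n / p : ℕ) : ZMod n) ≠ 0 := by
  rw [Ne, natCast_eq_zero_iff]
  exact Nat.not_dvd_of_pos_of_lt (Nat.div_pos (Nat.le_of_dvd (NeZero.pos n) hpn) (by omega))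
    (Nat.div_lt_self (NeZero.pos n) hp)

theorem mul_eq_zero_of_mem_zmultiples_div {p : ℕ} (hpn : p ∣ n) {k : ZMod n} (hk : p ∣ k.val)
    {u : ZMod n} (hu : u ∈ AddSubgroup.zmultiples ((n / p : ℕ) : ZMod n)) : u * k = 0 := by
  obtain ⟨m, rfl⟩ := AddSubgroup.mem_zmultiples_iff.mp hu
  have h : ((n / p : ℕ) : ZMod n) * k = 0 := by
    rw [← natCast_zmod_val k, ← Nat.cast_mul, natCast_eq_zero_iff]
    obtain ⟨l, hl⟩ := hk
    exact ⟨l, by rw [hl, ← mul_assoc, Nat.div_mul_cancel hpn]⟩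
  rw [smul_mul_assoc, h, smul_zero]

theorem sum_stdAddChar_eq_sum_card {X : Type*} (A : Finset X) (f : X → ZMod n) :
    ∑ s ∈ A, (stdAddChar (f s) : ℂ) =
      ∑ x, ((A.filter fun s => f s = x).card : ℂ) * stdAddChar x := by
  rw [← Finset.sum_fiberwise A f]
  refine Finset.sum_congr rfl fun x _ => ?_
  rw [← nsmul_eq_mul]
  exact Finset.sum_eq_card_nsmul fun s hs => by rw [(Finset.mem_filter.mp hs).2]

end ZMod

/-- Prescribed fibre cardinalities not exceeding those of `f` are realised by a subset. -/
theorem exists_finset_card_filter_eq {X Y : Type*} [Fintype X] [DecidableEq X] [DecidableEq Y]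
    (f : X → Y) (a : Y → ℕ) (ha : ∀ y, a y ≤ (Finset.univ.filter fun s => f s = y).card) :
    ∃ A : Finset X, ∀ y, (A.filter fun s => f s = y).card = a y := by
  choose T hT hcard using fun y => Finset.exists_subset_card_eq (ha y)
  refine ⟨Finset.univ.filter fun s => s ∈ T (f s), fun y => ?_⟩
  rw [← hcard y]
  congr 1
  ext s
  have := @hT y s
  simp only [Finset.mem_filter, Finset.mem_univ, true_and] at this ⊢
  grind


theorem balanced_iff_partition_two_primes (p q α β : ℕ) (hp : p.Prime)
    (hq : q.Prime) (hpq : p ≠ q) (hα : 1 ≤ α) (hβ : 1 ≤ β)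
    (n : ℕ) (hn : n = p ^ α * q ^ β)
    (X : Type*) [Fintype X] [DecidableEq X] (f : X → ZMod n) :
    (∑ s : X, Complex.exp (2 * Real.pi * Complex.I * (f s).val / n)) = 0 ↔
      ∃ Xp Xq : Finset X, Disjoint Xp Xq ∧ Xp ∪ Xq = Finset.univ ∧
        (∀ x y : ZMod n,
          x - y ∈ AddSubgroup.zmultiples ((n / p : ℕ) : ZMod n) →
            (Xp.filter (fun s => f s = x)).card =
              (Xp.filter (fun s => f s = y)).card) ∧
        (∀ x y : ZMod n,
          x - y ∈ AddSubgroup.zmultiples ((n / q : ℕ) : ZMod n) →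
            (Xq.filter (fun s => f s = x)).card =
              (Xq.filter (fun s => f s = y)).card) := by
  have hn0 : n ≠ 0 := by
    rw [hn]
    exact mul_ne_zero (pow_ne_zero _ hp.ne_zero) (pow_ne_zero _ hq.ne_zero)
  have : NeZero n := ⟨hn0⟩
  have hpn : p ∣ n := hn ▸ (dvd_pow_self p (by omega)).mul_right _
  have hqn : q ∣ n := hn ▸ (dvd_pow_self q (by omega)).mul_left _
  have hunit (k : ZMod n) : IsUnit k ∨ p ∣ k.val ∨ q ∣ k.val := by
    by_contra! hk
    refine hk.1 ?_
    rw [← ZMod.natCast_zmod_val k, ZMod.isUnit_iff_coprime]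
    generalize k.val = m at hk ⊢
    rw [hn]
    exact Nat.Coprime.mul_right (((hp.coprime_iff_not_dvd.mpr hk.2.1).symm).pow_right _)
      (((hq.coprime_iff_not_dvd.mpr hk.2.2).symm).pow_right _)
  simp only [← ZMod.stdAddChar_eq_exp]
  constructor
  · intro h
    rw [ZMod.sum_stdAddChar_eq_sum_card] at h
    obtain ⟨a, b, hab, ha, hb⟩ := exists_add_invariant_of_rectangle
      (AddSubgroup.zmultiples ((n / p : ℕ) : ZMod n))
      (AddSubgroup.zmultiples ((n / q : ℕ) : ZMod n))
      (fun x => (Finset.univ.filter fun s => f s = x).card) fun x u hu v hv => by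
        exact_mod_cast ZMod.rectangle_of_sum_mul_stdAddChar_eq_zero
          (fun x => ((Finset.univ.filter fun s => f s = x).card : ℤ)) (by exact_mod_cast h)
          (fun k => (hunit k).imp_right (Or.imp
            (fun hk => ZMod.mul_eq_zero_of_mem_zmultiples_div hpn hk hu)
            (fun hk => ZMod.mul_eq_zero_of_mem_zmultiples_div hqn hk hv))) x
    obtain ⟨A, hA⟩ := exists_finset_card_filter_eq f a fun y => by
      have := hab y
      omega
    have hAc (y : ZMod n) : (Aᶜ.filter fun s => f s = y).card = b y := by
      have h₁ := Finset.card_union_of_disjoint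
        (Finset.disjoint_filter_filter (p := fun s => f s = y) (q := fun s => f s = y)
          (disjoint_compl_right (a := A)))
      rw [← Finset.filter_union, Finset.union_compl, hA] at h₁
      have h₂ := hab y
      omega
    refine ⟨A, Aᶜ, disjoint_compl_right, Finset.union_compl A, fun x y hxy => ?_,
      fun x y hxy => ?_⟩
    · rw [hA, hA, ha x y hxy]
    · rw [hAc, hAc, hb x y hxy]
  · rintro ⟨Xp, Xq, hdisj, hunion, hXp, hXq⟩
    rw [← hunion, Finset.sum_union hdisj, ZMod.sum_stdAddChar_eq_sum_card,
      ZMod.sum_stdAddChar_eq_sum_card,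
      ZMod.sum_mul_stdAddChar_eq_zero_of_periodic _ (ZMod.natCast_div_ne_zero hp.one_lt hpn)
        fun x => by rw [hXp (x + _) x (by simp)],
      ZMod.sum_mul_stdAddChar_eq_zero_of_periodic _ (ZMod.natCast_div_ne_zero hq.one_lt hqn)
        fun x => by rw [hXq (x + _) x (by simp)],
      add_zero]
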